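/- arXiv:1406.7848 — 6 statements merged into one kernel-verified Lean document; each statement's English description precedes it below -/
import Mathlib

section
/- Let Σ be a λ-setting over N with codim Σ = p ≥ 1. Then q(s₁(Σ)) ≥ q(Σ) and q(s₂(Σ)) = q(Σ) + 1. -/
/-- A λ-setting over `N` (the ambient dimension `N` is kept as an external
parameter): a codimension `p` together with a tuple `λʲ` of natural numbers for
each level `j` (levels above `p` are irrelevant). -/
structure LambdaSetting where
  p : ℕ
  lam : ℕ → List ℕ

namespace LambdaSetting

/-- Validity over `N`: `p ≤ N`, the tuples above level `p` are empty, and all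
entries at levels `1,…,p` are `≥ 1`. -/
def IsValid (N : ℕ) (S : LambdaSetting) : Prop :=
  S.p ≤ N ∧ (∀ j, S.p < j → S.lam j = []) ∧
    (∀ j, 1 ≤ j → j ≤ S.p → ∀ x ∈ S.lam j, 1 ≤ x)

/-- `nz λ`: the number of nonzero entries of a tuple. -/
def nzList (l : List ℕ) : ℕ := (l.filter (· ≠ 0)).length

/-- `n(Σ) = Σ_{j=1}^{p} Σ_i min(j, λʲᵢ)`. -/
def nval (S : LambdaSetting) : ℕ :=
  ∑ j ∈ Finset.Icc 1 S.p, ((S.lam j).map fun x => min j x).sum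

/-- `q(Σ) = dim Σ − n(Σ) = N − p − n(Σ)` (as an integer). -/
def q (N : ℕ) (S : LambdaSetting) : ℤ := (N : ℤ) - S.p - S.nval

/-- `w(Σ) = Σ_{j=1}^{p} j·nz(λʲ)`. -/
def w (S : LambdaSetting) : ℕ := ∑ j ∈ Finset.Icc 1 S.p, j * nzList (S.lam j)

/-- `i(Σ) = codim Σ + w(Σ)`. -/
def idx (S : LambdaSetting) : ℕ := S.p + S.w

/-- `|Σ|`: the sum of all entries of all tuples `λ⁰, …, λᵖ`. -/
def size (S : LambdaSetting) : ℕ := ∑ j ∈ Finset.range (S.p + 1), (S.lam j).sum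

/-- `nz(Σ) = Σ_{j=0}^{p} nz(λʲ)`. -/
def nz (S : LambdaSetting) : ℕ := ∑ j ∈ Finset.range (S.p + 1), nzList (S.lam j)

/-- `Σ` is simple if every entry at level `j` (for `1 ≤ j ≤ p`) is `≥ j`. -/
def IsSimple (S : LambdaSetting) : Prop :=
  ∀ j, 1 ≤ j → j ≤ S.p → ∀ x ∈ S.lam j, j ≤ x

/-- The successor `s₁` (for `d = 0`) and `s₂` (for `d = 1`) of a λ-setting of
positive codimension.  If all tuples at levels `1,…,p` are empty, the
codimension drops by one; otherwise, letting `j₀` be the least level `≥ 1`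
with a nonempty tuple and `v` its first entry, the entry `v` is removed from
level `j₀` and `v − d` is placed at level `j₀ − 1` (appended to `λ⁰` when
`j₀ = 1`, and discarded when it is zero at a level `≥ 1`). -/
noncomputable def succ (d : ℕ) (S : LambdaSetting) : LambdaSetting :=
  if S.p = 0 then S
  else if ∀ j ∈ Finset.Icc 1 S.p, S.lam j = [] then
    ⟨S.p - 1, S.lam⟩
  else
    let j₀ := sInf {j | 1 ≤ j ∧ S.lam j ≠ []}
    let v := (S.lam j₀).headI
    ⟨S.p, fun j =>
      if j = j₀ then (S.lam j₀).tail
      else if j = j₀ - 1 then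
        if j₀ = 1 then S.lam 0 ++ [v - d]
        else if v - d = 0 then [] else [v - d]
      else S.lam j⟩

end LambdaSetting

namespace LambdaSetting

theorem nval_eq_zero {S : LambdaSetting} (h : ∀ j ∈ Finset.Icc 1 S.p, S.lam j = []) :
    S.nval = 0 :=
  Finset.sum_eq_zero fun j hj => by simp [h j hj]

theorem q_succ_of_forall_eq_nil (N d : ℕ) {S : LambdaSetting} (hp : 1 ≤ S.p)
    (h : ∀ j ∈ Finset.Icc 1 S.p, S.lam j = []) : (S.succ d).q N = S.q N + 1 := by
  have h_zero : nval ⟨S.p - 1, S.lam⟩ = 0 := nval_eq_zero fun j hj => h j <| by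
    simp only [Finset.mem_Icc] at hj ⊢
    omega
  rw [succ, if_neg (by omega), if_pos h]
  simp only [q, h_zero, nval_eq_zero h]
  omega

/-- If some tuple at a positive level is nonempty, the successor moves a positive entry `v` from a
level `k + 1` to the level `k`, which contributes nothing to `n(Σ)` beforehand. -/
theorem exists_nval_succ_add {N : ℕ} {S : LambdaSetting} (hS : S.IsValid N) (hp : 1 ≤ S.p)
    (h : ¬ ∀ j ∈ Finset.Icc 1 S.p, S.lam j = []) :
    ∃ k v : ℕ, 1 ≤ v ∧ ∀ d, (S.succ d).p = S.p ∧
      (S.succ d).nval + min (k + 1) v = S.nval + min k (v - d) := by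
  obtain ⟨m, h_first⟩ : ∃ m, m = sInf {j | 1 ≤ j ∧ S.lam j ≠ []} := ⟨_, rfl⟩
  have h_mem : m ∈ {j | 1 ≤ j ∧ S.lam j ≠ []} := by
    rw [h_first]
    refine Nat.sInf_mem ?_
    push Not at h
    obtain ⟨j, hj, hne⟩ := h
    exact ⟨j, (Finset.mem_Icc.1 hj).1, hne⟩
  have h_min : ∀ j, 1 ≤ j → j < m → S.lam j = [] := by
    intro j hj hjm
    rw [h_first] at hjm
    by_contra hne
    exact Nat.notMem_of_lt_sInf hjm ⟨hj, hne⟩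
  obtain ⟨hm, hne⟩ := h_mem
  have hmp : m ≤ S.p := by
    by_contra hlt
    exact hne (hS.2.1 m (by omega))
  obtain ⟨v, l, hl⟩ := List.exists_cons_of_ne_nil hne
  have hv : 1 ≤ v := hS.2.2 m hm hmp v (by simp [hl])
  obtain ⟨k, rfl⟩ : ∃ k, m = k + 1 := ⟨m - 1, by omega⟩
  refine ⟨k, v, hv, fun d => ?_⟩
  rw [succ, if_neg (by omega), if_neg h]
  refine ⟨rfl, ?_⟩
  simp only [nval, ← h_first, hl, List.headI_cons, List.tail_cons, Nat.add_sub_cancel]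
  have h_removed : ∑ j ∈ Finset.Icc 1 S.p, (if j = k + 1 then min (k + 1) v else 0)
      = min (k + 1) v := by
    rw [Finset.sum_ite_eq', if_pos (Finset.mem_Icc.2 ⟨hm, hmp⟩)]
  have h_added : ∑ j ∈ Finset.Icc 1 S.p, (if j = k then min k (v - d) else 0)
      = min k (v - d) := by
    rw [Finset.sum_ite_eq', ite_eq_left_iff, Finset.mem_Icc]
    intro hk
    have : k = 0 := by omega
    simp [this]
  rw [← h_removed, ← h_added, ← Finset.sum_add_distrib, ← Finset.sum_add_distrib]
  refine Finset.sum_congr rfl fun j hj => ?_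
  have hj := (Finset.mem_Icc.1 hj).1
  by_cases hj_first : j = k + 1
  · subst hj_first
    simp [hl, add_comm]
  · by_cases hj_prev : j = k
    · subst hj_prev
      have h_nil := h_min j hj (by omega)
      have hj_ne : j ≠ 0 := by omega
      by_cases hvd : v - d = 0 <;> simp [hvd, h_nil, hj_ne]
    · simp [hj_first, hj_prev]

end LambdaSetting

theorem q_succ_of_lambdaSetting (N : ℕ) (S : LambdaSetting)
    (hS : S.IsValid N) (hp : 1 ≤ S.p) :
    S.q N ≤ (S.succ 0).q N ∧ (S.succ 1).q N = S.q N + 1 := by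
  by_cases h : ∀ j ∈ Finset.Icc 1 S.p, S.lam j = []
  · have h_succ := fun d => LambdaSetting.q_succ_of_forall_eq_nil N d hp h
    exact ⟨by rw [h_succ]; omega, h_succ 1⟩
  · obtain ⟨k, v, hv, h_succ⟩ := LambdaSetting.exists_nval_succ_add hS hp h
    obtain ⟨h_codim₀, h_nval₀⟩ := h_succ 0
    obtain ⟨h_codim₁, h_nval₁⟩ := h_succ 1
    simp only [LambdaSetting.q, h_codim₀, h_codim₁]
    omega
end

section
/- Let (Σ, Σ̃) be a λ-pair over N of codimension p ≥ 1. Then: q(s₁(Σ,Σ̃)) ≥ q(Σ,Σ̃); q(s₂(Σ,Σ̃)) = q(Σ,Σ̃) + 1; i(s₁(Σ,Σ̃)) < i(Σ,Σ̃); i(s₂(Σ,Σ̃)) < i(Σ,Σ̃); t(s₁(Σ,Σ̃)) = t(Σ,Σ̃); and t(s₂(Σ,Σ̃)) ≥ t(Σ,Σ̃) − 1. -/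
/-- A λ-pair: a pair of λ-settings (required to have the same codimension via
`IsValid`). -/
structure LambdaPair where
  fst : LambdaSetting
  snd : LambdaSetting

namespace LambdaPair

/-- Validity of a λ-pair over `N`: both components are valid λ-settings over
`N` and they have the same codimension. -/
def IsValid (N : ℕ) (P : LambdaPair) : Prop :=
  P.fst.IsValid N ∧ P.snd.IsValid N ∧ P.fst.p = P.snd.p

/-- `q(Σ,Σ̃) = N − p − n(Σ) − n(Σ̃)`. -/
def q (N : ℕ) (P : LambdaPair) : ℤ :=
  (N : ℤ) - P.fst.p - P.fst.nval - P.snd.nval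

/-- `i(Σ,Σ̃) = p + w(Σ) + w(Σ̃)`. -/
def idx (P : LambdaPair) : ℕ := P.fst.p + P.fst.w + P.snd.w

/-- `t(Σ,Σ̃) = |Σ| + |Σ̃| − nz(Σ)` (as an integer). -/
def t (P : LambdaPair) : ℤ := (P.fst.size : ℤ) + P.snd.size - P.fst.nz

/-- The successor `s₁` (for `d = 0`) and `s₂` (for `d = 1`) of a λ-pair of
positive codimension: if all tuples at levels `1,…,p` of both components are
empty, take the successor of each component; otherwise, letting `j₀` be the
least level `≥ 1` at which one of the two components has a nonempty tuple,
take the successor of the second component if `λ̃^{j₀}` is nonempty and of the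
first component otherwise. -/
noncomputable def succ (d : ℕ) (P : LambdaPair) : LambdaPair :=
  have : Decidable (∀ j ∈ Finset.Icc 1 P.fst.p, P.fst.lam j = [] ∧ P.snd.lam j = []) :=
    Classical.dec _
  if ∀ j ∈ Finset.Icc 1 P.fst.p, P.fst.lam j = [] ∧ P.snd.lam j = [] then
    ⟨P.fst.succ d, P.snd.succ d⟩
  else
    let j₀ := sInf {j | 1 ≤ j ∧ (P.fst.lam j ≠ [] ∨ P.snd.lam j ≠ [])}
    if P.snd.lam j₀ ≠ [] then ⟨P.fst, P.snd.succ d⟩ else ⟨P.fst.succ d, P.snd⟩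

end LambdaPair

theorem Finset.sum_range_add_eq_of_eq_off_succ {n k : ℕ} (hk : k + 1 < n) (g g' : ℕ → ℕ)
    (h : ∀ j, j ≠ k → j ≠ k + 1 → g' j = g j) :
    ∑ j ∈ Finset.range n, g' j + (g k + g (k + 1)) =
      ∑ j ∈ Finset.range n, g j + (g' k + g' (k + 1)) := by
  have hk0 : k ∈ (Finset.range n).erase (k + 1) := by
    simp only [Finset.mem_erase, Finset.mem_range]; omega
  have hk1 : k + 1 ∈ Finset.range n := Finset.mem_range.2 hk
  rw [← Finset.add_sum_erase _ g hk1, ← Finset.add_sum_erase _ g' hk1,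
    ← Finset.add_sum_erase _ g hk0, ← Finset.add_sum_erase _ g' hk0]
  have : ∑ j ∈ ((Finset.range n).erase (k + 1)).erase k, g' j =
      ∑ j ∈ ((Finset.range n).erase (k + 1)).erase k, g j := by
    refine Finset.sum_congr rfl fun j hj => ?_
    simp only [Finset.mem_erase] at hj
    exact h j hj.1 hj.2.1
  omega

theorem Finset.sum_Icc_one_eq_sum_range {f : ℕ → ℕ} (hf : f 0 = 0) (n : ℕ) :
    ∑ j ∈ Finset.Icc 1 n, f j = ∑ j ∈ Finset.range (n + 1), f j := by
  rw [Finset.sum_range_succ', hf, add_zero, Finset.range_eq_Ico, Finset.sum_Ico_add' f 0 n 1]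
  rfl

namespace LambdaSetting

theorem nval_eq_sum_range (S : LambdaSetting) :
    S.nval = ∑ j ∈ Finset.range (S.p + 1), ((S.lam j).map fun x => min j x).sum :=
  Finset.sum_Icc_one_eq_sum_range (by simp) _

theorem w_eq_sum_range (S : LambdaSetting) :
    S.w = ∑ j ∈ Finset.range (S.p + 1), j * nzList (S.lam j) :=
  Finset.sum_Icc_one_eq_sum_range (by simp) _

@[simp] theorem nzList_nil : nzList [] = 0 := rfl

theorem nzList_cons (x : ℕ) (l : List ℕ) :
    nzList (x :: l) = (if x = 0 then 0 else 1) + nzList l := by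
  by_cases hx : x = 0 <;> simp [nzList, hx, add_comm]

theorem nzList_append (l₁ l₂ : List ℕ) : nzList (l₁ ++ l₂) = nzList l₁ + nzList l₂ := by
  simp [nzList]

/-- The successor of a setting with a nonempty tuple at some level `≥ 1`, in terms of the least
such level `k + 1` and the entry `v` moved from it to level `k`. -/
theorem exists_succ_eq {N : ℕ} {S : LambdaSetting} (hS : S.IsValid N)
    {i : ℕ} (hi : 1 ≤ i) (hne : S.lam i ≠ []) (d : ℕ) :
    ∃ k v l, k + 1 ≤ S.p ∧ S.lam (k + 1) = v :: l ∧ 1 ≤ v ∧ (k ≠ 0 → S.lam k = []) ∧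
      (S.succ d).p = S.p ∧ (S.succ d).lam (k + 1) = l ∧
      (S.succ d).lam k =
        (if k = 0 then S.lam 0 ++ [v - d] else if v - d = 0 then [] else [v - d]) ∧
      ∀ j, j ≠ k → j ≠ k + 1 → (S.succ d).lam j = S.lam j := by
  obtain ⟨-, htop, hpos⟩ := hS
  have hle : ∀ j, S.lam j ≠ [] → j ≤ S.p := fun j hj => not_lt.1 fun h => hj (htop j h)
  have hmem := Nat.sInf_mem (s := {j | 1 ≤ j ∧ S.lam j ≠ []}) ⟨i, hi, hne⟩
  have hmin : ∀ j, 1 ≤ j → S.lam j ≠ [] → sInf {j | 1 ≤ j ∧ S.lam j ≠ []} ≤ j :=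
    fun j h₁ h₂ => Nat.sInf_le ⟨h₁, h₂⟩
  have hp : S.p ≠ 0 := by have := hle i hne; omega
  have hex : ¬ ∀ j ∈ Finset.Icc 1 S.p, S.lam j = [] :=
    fun h => hne (h i (Finset.mem_Icc.2 ⟨hi, hle i hne⟩))
  rw [succ, if_neg hp, if_neg hex]
  generalize sInf {j | 1 ≤ j ∧ S.lam j ≠ []} = m at hmem hmin
  obtain ⟨hm, hm'⟩ := hmem
  obtain ⟨k, rfl⟩ := Nat.exists_eq_add_of_le' hm
  obtain ⟨v, l, hvl⟩ := List.exists_cons_of_ne_nil hm'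
  refine ⟨k, v, l, hle _ hm', hvl, hpos _ hm (hle _ hm') v (by simp [hvl]), fun hk => ?_, rfl,
    by simp [hvl], by simp [hvl], fun j h₁ h₂ => by simp [h₁, h₂]⟩
  by_contra h
  have := hmin k (by omega) h
  omega

theorem succ_of_lam_ne_nil {N : ℕ} {S : LambdaSetting} (hS : S.IsValid N)
    {i : ℕ} (hi : 1 ≤ i) (hne : S.lam i ≠ []) {d : ℕ} (hd : d ≤ 1) :
    (S.succ d).p = S.p ∧ (S.succ d).nval + d ≤ S.nval ∧
      (d = 1 → (S.succ d).nval + 1 = S.nval) ∧ (S.succ d).w < S.w ∧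
      (S.succ d).size + d = S.size ∧ (S.succ d).nz ≤ S.nz ∧
      (d = 0 → (S.succ d).nz = S.nz) := by
  obtain ⟨k, v, l, hk, hvl, hv, hnil, hp, hl, hnew, hoff⟩ := exists_succ_eq hS hi hne d
  have key (f : ℕ → List ℕ → ℕ) := Finset.sum_range_add_eq_of_eq_off_succ
    (Nat.lt_succ_of_le hk) (fun j => f j (S.lam j)) (fun j => f j ((S.succ d).lam j))
    fun j h₁ h₂ => congrArg (f j) (hoff j h₁ h₂)
  have hn := key fun j l => (l.map fun x => min j x).sum
  have hw := key fun j l => j * nzList l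
  have hs := key fun _ l => l.sum
  have hz := key fun _ l => nzList l
  rw [nval_eq_sum_range, nval_eq_sum_range, w_eq_sum_range, w_eq_sum_range, size, size, nz, nz, hp]
  simp only [hl, hnew, hvl] at hn hw hs hz
  generalize ∑ j ∈ Finset.range (S.p + 1), (((S.succ d).lam j).map fun x => min j x).sum = n' at *
  generalize ∑ j ∈ Finset.range (S.p + 1), j * nzList ((S.succ d).lam j) = w' at *
  generalize ∑ j ∈ Finset.range (S.p + 1), ((S.succ d).lam j).sum = s' at *
  generalize ∑ j ∈ Finset.range (S.p + 1), nzList ((S.succ d).lam j) = z' at *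
  have hv0 : v ≠ 0 := by omega
  rcases Nat.eq_zero_or_pos k with rfl | hk0
  · simp [nzList_cons, nzList_append, hv0] at hn hw hs hz
    split_ifs at hz <;> omega
  · have hk0' : k ≠ 0 := by omega
    by_cases hvd : v - d = 0
    · simp [nzList_cons, hv0, hk0', hnil hk0', hvd, add_mul, mul_add] at hn hw hs hz
      omega
    · simp [nzList_cons, hv0, hk0', hnil hk0', hvd, mul_add] at hn hw hs hz
      omega

theorem succ_of_lam_eq_nil {S : LambdaSetting} (hp : 1 ≤ S.p)
    (h : ∀ j ∈ Finset.Icc 1 S.p, S.lam j = []) (d : ℕ) :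
    (S.succ d).p + 1 = S.p ∧ (S.succ d).nval = S.nval ∧ (S.succ d).w = S.w ∧
      (S.succ d).size = S.size ∧ (S.succ d).nz = S.nz := by
  rw [succ, if_neg (by omega), if_pos h]
  obtain ⟨p, lam⟩ := S
  obtain ⟨p, rfl⟩ := Nat.exists_eq_add_of_le' hp
  have htop : lam (p + 1) = [] := h (p + 1) (by simp)
  simp [nval_eq_sum_range, w_eq_sum_range, size, nz, Finset.sum_range_succ _ (p + 1), htop]

end LambdaSetting

namespace LambdaPair

theorem succ_cases {N : ℕ} {P : LambdaPair} (hP : P.IsValid N) :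
    ((∀ j ∈ Finset.Icc 1 P.fst.p, P.fst.lam j = []) ∧
      (∀ j ∈ Finset.Icc 1 P.snd.p, P.snd.lam j = []) ∧
      ∀ d, P.succ d = ⟨P.fst.succ d, P.snd.succ d⟩) ∨
    (∃ i, 1 ≤ i ∧ P.snd.lam i ≠ [] ∧ ∀ d, P.succ d = ⟨P.fst, P.snd.succ d⟩) ∨
    ∃ i, 1 ≤ i ∧ P.fst.lam i ≠ [] ∧ ∀ d, P.succ d = ⟨P.fst.succ d, P.snd⟩ := by
  by_cases h : ∀ j ∈ Finset.Icc 1 P.fst.p, P.fst.lam j = [] ∧ P.snd.lam j = []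
  · refine Or.inl ⟨fun j hj => (h j hj).1, fun j hj => (h j (hP.2.2 ▸ hj)).2, fun d => ?_⟩
    rw [succ, if_pos h]
  · right
    have hmem : sInf {j | 1 ≤ j ∧ (P.fst.lam j ≠ [] ∨ P.snd.lam j ≠ [])} ∈
        {j | 1 ≤ j ∧ (P.fst.lam j ≠ [] ∨ P.snd.lam j ≠ [])} := by
      push Not at h
      obtain ⟨j, hj, hne⟩ := h
      exact Nat.sInf_mem ⟨j, (Finset.mem_Icc.1 hj).1, Classical.or_iff_not_imp_left.2
        fun hf => hne (not_not.1 hf)⟩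
    by_cases hs : P.snd.lam (sInf {j | 1 ≤ j ∧ (P.fst.lam j ≠ [] ∨ P.snd.lam j ≠ [])}) = []
    · refine Or.inr ⟨_, hmem.1, hmem.2.resolve_right (not_not.2 hs), fun d => ?_⟩
      rw [succ, if_neg h]
      exact if_neg (not_not.2 hs)
    · refine Or.inl ⟨_, hmem.1, hs, fun d => ?_⟩
      rw [succ, if_neg h]
      exact if_pos hs

end LambdaPair

theorem succ_of_lambdaPair (N : ℕ) (P : LambdaPair)
    (hP : P.IsValid N) (hp : 1 ≤ P.fst.p) :
    P.q N ≤ (P.succ 0).q N ∧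
    (P.succ 1).q N = P.q N + 1 ∧
    (P.succ 0).idx < P.idx ∧
    (P.succ 1).idx < P.idx ∧
    (P.succ 0).t = P.t ∧
    P.t - 1 ≤ (P.succ 1).t := by
  rcases LambdaPair.succ_cases hP with ⟨hf, hs, h⟩ | ⟨i, hi, hne, h⟩ | ⟨i, hi, hne, h⟩
  · have f₀ := LambdaSetting.succ_of_lam_eq_nil hp hf 0
    have f₁ := LambdaSetting.succ_of_lam_eq_nil hp hf 1
    have s₀ := LambdaSetting.succ_of_lam_eq_nil (hP.2.2 ▸ hp) hs 0
    have s₁ := LambdaSetting.succ_of_lam_eq_nil (hP.2.2 ▸ hp) hs 1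
    simp only [h, LambdaPair.q, LambdaPair.idx, LambdaPair.t]
    omega
  · have h₀ := LambdaSetting.succ_of_lam_ne_nil hP.2.1 hi hne zero_le_one
    have h₁ := LambdaSetting.succ_of_lam_ne_nil hP.2.1 hi hne le_rfl
    simp only [h, LambdaPair.q, LambdaPair.idx, LambdaPair.t]
    omega
  · have h₀ := LambdaSetting.succ_of_lam_ne_nil hP.1 hi hne zero_le_one
    have h₁ := LambdaSetting.succ_of_lam_ne_nil hP.1 hi hne le_rfl
    simp only [h, LambdaPair.q, LambdaPair.idx, LambdaPair.t]
    omega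
end

section
/- Let Σ be a simple λ-setting over N with codim Σ = p, and set q := q(Σ). Then the iterates s₂ⁱ(Σ) are well defined and simple for all 0 ≤ i ≤ N − q (the successor being applicable because s₂ⁱ(Σ) has positive codimension whenever i < N − q), with q(s₂ⁱ(Σ)) = q + i. Moreover: (1) the λ-setting s₂^{N−q}(Σ) has codimension 0, and its tuple at level 0 equals, as a multiset, the union (with multiplicity) of λ⁰ and the multiset {λʲᵢ − j : 1 ≤ j ≤ p, 1 ≤ i ≤ m_j}; (2) Σ_{i=0}^{N−q−1} deg(s₂ⁱ(Σ)) = b_Σ. -/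
namespace LambdaSetting

/-- `deg Σ` with respect to a sequence of degrees `e` (indexed from `1`): it is
`e j₀` where `j₀` is the least level `≥ 1` with a nonempty tuple, and `e p` if
all tuples at levels `1,…,p` are empty. -/
noncomputable def deg (e : ℕ → ℕ) (S : LambdaSetting) : ℕ :=
  have : Decidable (∀ j ∈ Finset.Icc 1 S.p, S.lam j = []) := Classical.dec _
  if ∀ j ∈ Finset.Icc 1 S.p, S.lam j = [] then e S.p
  else e (sInf {j | 1 ≤ j ∧ S.lam j ≠ []})

/-- `b_Σ = Σ_{i=1}^{p} e_i + Σ_{j=1}^{p} m_j · (Σ_{i=1}^{j} e_i)`. -/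
def bSigma (e : ℕ → ℕ) (S : LambdaSetting) : ℕ :=
  (∑ i ∈ Finset.Icc 1 S.p, e i) +
    ∑ j ∈ Finset.Icc 1 S.p, (S.lam j).length * ∑ i ∈ Finset.Icc 1 j, e i

end LambdaSetting

namespace LambdaSetting

/-- The sum of `h j x` over all entries `x` at all levels `j` of a λ-setting. -/
def entrySum {M : Type*} [AddCommMonoid M] (h : ℕ → ℕ → M) (S : LambdaSetting) : M :=
  ∑ j ∈ Finset.range (S.p + 1), ((S.lam j).map (h j)).sum

theorem entrySum_eq_add_sum_Icc {M : Type*} [AddCommMonoid M] (h : ℕ → ℕ → M)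
    (S : LambdaSetting) :
    S.entrySum h =
      ((S.lam 0).map (h 0)).sum + ∑ j ∈ Finset.Icc 1 S.p, ((S.lam j).map (h j)).sum := by
  rw [entrySum, Finset.range_eq_Ico, Finset.sum_eq_sum_Ico_succ_bot (Nat.succ_pos _)]
  rfl

theorem nval_eq_entrySum (S : LambdaSetting) : S.nval = S.entrySum fun j x => min j x := by
  simp [entrySum_eq_add_sum_Icc, nval]

theorem bSigma_eq_entrySum (e : ℕ → ℕ) (S : LambdaSetting) :
    S.bSigma e =
      (∑ i ∈ Finset.Icc 1 S.p, e i) + S.entrySum fun j _ => ∑ i ∈ Finset.Icc 1 j, e i := by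
  simp [entrySum_eq_add_sum_Icc, bSigma]

/-- The multiset of the numbers `x - j`, for all entries `x` at all levels `j`. -/
def shiftedEntries (S : LambdaSetting) : Multiset ℕ := S.entrySum fun j x => {x - j}

theorem sum_map_singleton_eq_coe_map {α β : Type*} (f : α → β) (l : List α) :
    (l.map fun x => ({f x} : Multiset β)).sum = (l.map f : List β) := by
  induction l with
  | nil => rfl
  | cons a l ih => simp [ih]

theorem shiftedEntries_eq (S : LambdaSetting) :
    S.shiftedEntries = (S.lam 0 : Multiset ℕ) +
      ∑ j ∈ Finset.Icc 1 S.p, (((S.lam j).map fun x => x - j : List ℕ) : Multiset ℕ) := by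
  simp only [shiftedEntries, entrySum_eq_add_sum_Icc, sum_map_singleton_eq_coe_map]
  simp

/-- Moving the first entry at level `k + 1` to level `k`, lowered by one. -/
def moveDown (S : LambdaSetting) (k v : ℕ) (l : List ℕ) : LambdaSetting :=
  ⟨S.p, Function.update (Function.update S.lam (k + 1) l) k (S.lam k ++ [v])⟩

theorem entrySum_moveDown {M : Type*} [AddCommMonoid M] (h : ℕ → ℕ → M)
    {S : LambdaSetting} {k v : ℕ} {l : List ℕ} (hk : k + 1 ≤ S.p)
    (hl : S.lam (k + 1) = (v + 1) :: l) :
    (S.moveDown k v l).entrySum h + h (k + 1) (v + 1) = S.entrySum h + h k v := by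
  have split (f : ℕ → M) : ∑ j ∈ Finset.range (S.p + 1), f j =
      f k + (f (k + 1) + ∑ j ∈ ((Finset.range (S.p + 1)).erase k).erase (k + 1), f j) := by
    rw [Finset.add_sum_erase _ _ (by simp; omega), Finset.add_sum_erase _ _ (by simp; omega)]
  simp only [entrySum, moveDown]
  rw [split, split fun j => ((S.lam j).map (h j)).sum]
  have rest : ∀ j ∈ ((Finset.range (S.p + 1)).erase k).erase (k + 1),
      ((Function.update (Function.update S.lam (k + 1) l) k (S.lam k ++ [v]) j).map (h j)).sum =
        ((S.lam j).map (h j)).sum := by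
    intro j hj
    simp only [Finset.mem_erase] at hj
    rw [Function.update_of_ne hj.2.1, Function.update_of_ne hj.1]
  rw [Finset.sum_congr rfl rest]
  simp [hl]
  abel

/-- The two cases for the successor `s₂` of a simple λ-setting of positive codimension. -/
theorem succ_one_cases (S : LambdaSetting) (hp : S.p ≠ 0)
    (hempty : ∀ j, S.p < j → S.lam j = []) (hsimple : S.IsSimple) :
    ((∀ j ∈ Finset.Icc 1 S.p, S.lam j = []) ∧ succ 1 S = ⟨S.p - 1, S.lam⟩ ∧
      ∀ e, deg e S = e S.p) ∨
    ∃ k v l, k + 1 ≤ S.p ∧ S.lam (k + 1) = (v + 1) :: l ∧ k ≤ v ∧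
      succ 1 S = S.moveDown k v l ∧ ∀ e, deg e S = e (k + 1) := by
  by_cases hall : ∀ j ∈ Finset.Icc 1 S.p, S.lam j = []
  · left
    refine ⟨hall, ?_, fun e => ?_⟩
    · rw [succ, if_neg hp, if_pos hall]
    · rw [deg, if_pos hall]
  · right
    have hne : {j | 1 ≤ j ∧ S.lam j ≠ []}.Nonempty := by
      push Not at hall
      obtain ⟨j, hj, hj'⟩ := hall
      exact ⟨j, (Finset.mem_Icc.1 hj).1, hj'⟩
    obtain ⟨h1, h2⟩ := Nat.sInf_mem hne
    have hmin : ∀ j, 1 ≤ j → j < sInf {j | 1 ≤ j ∧ S.lam j ≠ []} → S.lam j = [] := by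
      intro j hj hlt
      by_contra h
      exact Nat.notMem_of_lt_sInf hlt ⟨hj, h⟩
    have hdeg : ∀ e, deg e S = e (sInf {j | 1 ≤ j ∧ S.lam j ≠ []}) := fun e => by
      rw [deg, if_neg hall]
    have hsucc := Eq.refl (succ 1 S)
    conv_rhs at hsucc => rw [succ, if_neg hp, if_neg hall]
    generalize sInf {j | 1 ≤ j ∧ S.lam j ≠ []} = j₀ at h1 h2 hmin hdeg hsucc
    obtain ⟨k, rfl⟩ : ∃ k, j₀ = k + 1 := ⟨j₀ - 1, by omega⟩
    have hkp : k + 1 ≤ S.p := by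
      by_contra h
      exact h2 (hempty _ (by omega))
    obtain ⟨x, l, hl⟩ := List.exists_cons_of_ne_nil h2
    have hx : k + 1 ≤ x := hsimple _ h1 hkp x (by simp [hl])
    obtain ⟨v, rfl⟩ : ∃ v, x = v + 1 := ⟨x - 1, by omega⟩
    refine ⟨k, v, l, hkp, hl, by omega, ?_, hdeg⟩
    rw [hsucc, moveDown]
    dsimp only
    congr 1
    funext j
    by_cases hj : j = k
    · subst hj
      rcases Nat.eq_zero_or_pos j with rfl | hpos
      · simp [hl]
      · have hv : v ≠ 0 := by omega
        simp [hl, hmin j hpos (by omega), hv, hpos.ne']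
    · by_cases hj' : j = k + 1
      · subst hj'
        simp [hl]
      · simp [hj', hj]

/-- One application of `s₂` to a simple λ-setting of positive codimension. -/
theorem succ_one_spec {N : ℕ} {S : LambdaSetting} (hp : S.p ≠ 0) (hS : S.IsValid N)
    (hsimple : S.IsSimple) :
    (succ 1 S).IsValid N ∧ (succ 1 S).IsSimple ∧
      (succ 1 S).p + (succ 1 S).nval + 1 = S.p + S.nval ∧
      (succ 1 S).shiftedEntries = S.shiftedEntries ∧
      ∀ e, deg e S + (succ 1 S).bSigma e = S.bSigma e := by
  obtain ⟨hpN, hempty, hpos⟩ := hS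
  rcases succ_one_cases S hp hempty hsimple with
    ⟨hall, hsucc, hdeg⟩ | ⟨k, v, l, hk, hl, hkv, hsucc, hdeg⟩
  · simp only [hdeg]
    rw [hsucc]
    obtain ⟨p, lam⟩ := S
    obtain ⟨p, rfl⟩ := Nat.exists_eq_succ_of_ne_zero hp
    simp only [Nat.succ_eq_add_one, Nat.add_sub_cancel] at *
    have htop : lam (p + 1) = [] := hall _ (by simp)
    refine ⟨⟨(Nat.le_succ p).trans hpN, fun j hj => ?_, fun j h1 h2 => hpos j h1 (by simp at h2 ⊢; omega)⟩,
      fun j h1 h2 => hsimple j h1 (by simp at h2 ⊢; omega), ?_, ?_, fun e => ?_⟩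
    · rcases eq_or_lt_of_le (Nat.succ_le_of_lt hj) with h | h
      · rw [← h]; exact htop
      · exact hempty j h
    · simp only [nval_eq_entrySum, entrySum, Finset.sum_range_succ _ (p + 1), htop]
      simp
      omega
    · simp only [shiftedEntries, entrySum, Finset.sum_range_succ _ (p + 1), htop]
      simp
    · simp only [bSigma_eq_entrySum, entrySum, Finset.sum_range_succ _ (p + 1), htop,
        Finset.sum_Icc_succ_top (Nat.le_add_left 1 p)]
      simp
      omega
  · simp only [hdeg]
    rw [hsucc]
    have hsimple' : (S.moveDown k v l).IsSimple := by
      intro j h1 h2 x hx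
      by_cases hj : j = k
      · subst hj
        simp only [moveDown, Function.update_self, List.mem_append, List.mem_singleton] at hx
        rcases hx with hx | rfl
        · exact hsimple j h1 h2 x hx
        · exact hkv
      · by_cases hj' : j = k + 1
        · subst hj'
          exact hsimple _ h1 h2 x (by simp_all [moveDown])
        · exact hsimple _ h1 h2 x (by simpa [moveDown, hj, hj'] using hx)
    refine ⟨⟨hpN, fun j hj => ?_, fun j h1 h2 x hx => h1.trans (hsimple' j h1 h2 x hx)⟩,
      hsimple', ?_, ?_, fun e => ?_⟩
    · have hj' : S.p < j := hj
      have h1 : j ≠ k := by omega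
      have h2 : j ≠ k + 1 := by omega
      simpa [moveDown, h1, h2] using hempty j hj'
    · have := entrySum_moveDown (fun j x => min j x) hk hl
      rw [nval_eq_entrySum, nval_eq_entrySum]
      have hp' : (S.moveDown k v l).p = S.p := rfl
      omega
    · have := entrySum_moveDown (fun j x => ({x - j} : Multiset ℕ)) hk hl
      rw [Nat.add_sub_add_right] at this
      exact add_right_cancel this
    · have := entrySum_moveDown (fun j _ => ∑ i ∈ Finset.Icc 1 j, e i) hk hl
      rw [Finset.sum_Icc_succ_top (Nat.le_add_left 1 k)] at this
      rw [bSigma_eq_entrySum, bSigma_eq_entrySum]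
      have hp' : (S.moveDown k v l).p = S.p := rfl
      rw [hp']
      omega

end LambdaSetting

/-- For a simple λ-setting `Σ` over `N` of codimension `p` with `q := q(Σ)`,
the iterates `s₂ⁱ(Σ)` are well defined (the successor being applicable since
they have positive codimension for `i < N − q`) and simple for `0 ≤ i ≤ N − q`,
with `q(s₂ⁱ(Σ)) = q + i`; here `N − q = p + n(Σ)`.  Moreover `s₂^{N−q}(Σ)` has
codimension `0` and its tuple at level `0` is, as a multiset, the union of `λ⁰`
and `{λʲᵢ − j : 1 ≤ j ≤ p, 1 ≤ i ≤ m_j}`; and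
`Σ_{i=0}^{N−q−1} deg(s₂ⁱ(Σ)) = b_Σ`. -/
theorem iterate_s₂_of_simple (N : ℕ) (e : ℕ → ℕ) (he : ∀ i, 1 ≤ e i)
    (S : LambdaSetting) (hS : S.IsValid N) (hsimple : S.IsSimple) :
    (∀ i ≤ S.p + S.nval,
        ((LambdaSetting.succ 1)^[i] S).IsValid N ∧
        ((LambdaSetting.succ 1)^[i] S).IsSimple ∧
        ((LambdaSetting.succ 1)^[i] S).q N = S.q N + i) ∧
    (∀ i < S.p + S.nval, 1 ≤ ((LambdaSetting.succ 1)^[i] S).p) ∧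
    ((LambdaSetting.succ 1)^[S.p + S.nval] S).p = 0 ∧
    ((((LambdaSetting.succ 1)^[S.p + S.nval] S).lam 0 : Multiset ℕ) =
      ((S.lam 0 : Multiset ℕ) +
        ∑ j ∈ Finset.Icc 1 S.p, (((S.lam j).map fun x => x - j : List ℕ) : Multiset ℕ))) ∧
    (∑ i ∈ Finset.range (S.p + S.nval),
        LambdaSetting.deg e ((LambdaSetting.succ 1)^[i] S)) =
      LambdaSetting.bSigma e S := by
  rw [← LambdaSetting.shiftedEntries_eq]
  generalize hn : S.p + S.nval = n
  induction n generalizing S with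
  | zero =>
    have hp : S.p = 0 := by omega
    refine ⟨fun i hi => ?_, by simp, hp, ?_, ?_⟩
    · obtain rfl : i = 0 := by omega
      simpa using ⟨hS, hsimple⟩
    · simp [LambdaSetting.shiftedEntries_eq, hp]
    · simp [LambdaSetting.bSigma, hp]
  | succ n ih =>
    have hp : S.p ≠ 0 := by
      intro hp
      simp [LambdaSetting.nval, hp] at hn
    obtain ⟨hS', hsimple', hn', hentries, hb⟩ := LambdaSetting.succ_one_spec hp hS hsimple
    obtain ⟨h1, h2, h3, h4, h5⟩ := ih _ hS' hsimple' (by omega)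
    refine ⟨fun i hi => ?_, fun i hi => ?_, h3, h4.trans hentries, ?_⟩
    · cases i with
      | zero => simpa using ⟨hS, hsimple⟩
      | succ i =>
        obtain ⟨hv, hs, hq⟩ := h1 i (by omega)
        refine ⟨hv, hs, hq.trans ?_⟩
        simp only [LambdaSetting.q]
        omega
    · cases i with
      | zero => exact Nat.one_le_iff_ne_zero.2 hp
      | succ i => exact h2 i (by omega)
    · rw [Finset.sum_range_succ', ← hb e, ← h5, add_comm]
      rfl
end

section
/- Let K be a field and p, n, q, r natural numbers with n ≤ p and r ≤ n. Let A : K^p → K^n be a surjective linear map and let Γ ⊆ K^n be a linear subspace of dimension r. Then the set { B ∈ Hom_K(K^q, K^p) : range(A ∘ B) ⊆ Γ } is a linear subspace of Hom_K(K^q, K^p) of dimension q·(p − n + r). -/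
/-- The preimage of `Γ` under a surjective linear map has dimension `dim ker f + dim Γ`. -/
theorem Submodule.finrank_comap_add_finrank_of_surjective {K V W : Type*} [Field K]
    [AddCommGroup V] [Module K V] [FiniteDimensional K V] [AddCommGroup W] [Module K W]
    [FiniteDimensional K W] {f : V →ₗ[K] W} (hf : Function.Surjective f) (Γ : Submodule K W) :
    Module.finrank K (Γ.comap f) + Module.finrank K W =
      Module.finrank K V + Module.finrank K Γ := by
  have hker : LinearMap.ker (Γ.mkQ ∘ₗ f) = Γ.comap f := by
    rw [LinearMap.ker_comp, Submodule.ker_mkQ]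
  have hrange : LinearMap.range (Γ.mkQ ∘ₗ f) = ⊤ :=
    LinearMap.range_eq_top.2 (Γ.mkQ_surjective.comp hf)
  have h := (Γ.mkQ ∘ₗ f).finrank_range_add_finrank_ker
  rw [hker, hrange, finrank_top] at h
  have hΓ := Γ.finrank_quotient_add_finrank
  omega

/-- The linear maps `V → W` with range in a subspace `U` form a subspace of dimension
`dim V * dim U`. -/
theorem Submodule.exists_linearMap_range_le_finrank {K V W : Type*} [Field K]
    [AddCommGroup V] [Module K V] [FiniteDimensional K V] [AddCommGroup W] [Module K W]
    [FiniteDimensional K W] (U : Submodule K W) :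
    ∃ S : Submodule K (V →ₗ[K] W), (S : Set (V →ₗ[K] W)) = {B | LinearMap.range B ≤ U} ∧
      Module.finrank K S = Module.finrank K V * Module.finrank K U := by
  refine ⟨LinearMap.range (LinearMap.compRight K U.subtype (M := V)), ?_, ?_⟩
  · ext B
    constructor
    · rintro ⟨C, rfl⟩
      rintro _ ⟨x, rfl⟩
      exact (C x).2
    · intro hB
      exact ⟨B.codRestrict U fun x => hB ⟨x, rfl⟩, rfl⟩
  · rw [LinearMap.finrank_range_of_inj, Module.finrank_linearMap]
    intro C D h
    ext x
    exact LinearMap.congr_fun h x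

/-- If `A : K^p → K^n` is a surjective linear map (with `n ≤ p`) and
`Γ ⊆ K^n` is a subspace of dimension `r ≤ n`, then
`{B ∈ Hom(K^q, K^p) : range (A ∘ B) ⊆ Γ}` is a linear subspace of
`Hom(K^q, K^p)` of dimension `q·(p − n + r)`. -/
theorem dim_maps_with_range_in_preimage
    (K : Type*) [Field K] (p n q r : ℕ) (hnp : n ≤ p) (hrn : r ≤ n)
    (A : (Fin p → K) →ₗ[K] (Fin n → K)) (hA : Function.Surjective A)
    (Γ : Submodule K (Fin n → K)) (hΓ : Module.finrank K Γ = r) :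
    ∃ S : Submodule K ((Fin q → K) →ₗ[K] (Fin p → K)),
      (S : Set ((Fin q → K) →ₗ[K] (Fin p → K))) =
        {B | LinearMap.range (A.comp B) ≤ Γ} ∧
      Module.finrank K S = q * (p - n + r) := by
  obtain ⟨S, hS, hdim⟩ :=
    Submodule.exists_linearMap_range_le_finrank (V := Fin q → K) (Γ.comap A)
  refine ⟨S, ?_, ?_⟩
  · simp only [hS, LinearMap.range_comp, Submodule.map_le_iff_le_comap]
  · have h := Submodule.finrank_comap_add_finrank_of_surjective hA Γ
    rw [Module.finrank_fin_fun, Module.finrank_fin_fun, hΓ] at h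
    rw [hdim, Module.finrank_fin_fun]
    congr 1
    omega
end

section
/- Let N ≥ 1, ε ≥ 1 and e ≥ 1 be integers. Let z ∈ ℂ^N and ξ ∈ ℂ^N with ξ ≠ 0, and suppose that for every index i ∈ {1, …, N} it is not the case that both z_i = 0 and ξ_i = 0. Let 𝔸_ε denote the ℂ-vector space of polynomials in ℂ[x₁, …, x_N] of total degree at most ε. For each q ∈ {1, …, N} define linear functionals on 𝔸_ε by b_q(u) := z_q · u(z) and β_q(u) := z_q · Σ_{k=1}^{N} (∂u/∂x_k)(z) · ξ_k + e · u(z) · ξ_q. Then for every q ∈ {1, …, N}: β_q is not the zero functional, and ker b_q ≠ ker β_q (as linear subspaces of 𝔸_ε). -/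
/-- Evaluation at `z` as a linear functional on the space `𝔸_ε` of complex
polynomials in `N` variables of total degree at most `ε`. -/
noncomputable def evalDeg (N ε : ℕ) (z : Fin N → ℂ) :
    ↥(MvPolynomial.restrictTotalDegree (Fin N) ℂ ε) →ₗ[ℂ] ℂ :=
  (MvPolynomial.aeval z).toLinearMap.comp
    (MvPolynomial.restrictTotalDegree (Fin N) ℂ ε).subtype

/-- The linear functional `u ↦ (∂u/∂x_k)(z)` on `𝔸_ε`. -/
noncomputable def pderivEvalDeg (N ε : ℕ) (z : Fin N → ℂ) (k : Fin N) :
    ↥(MvPolynomial.restrictTotalDegree (Fin N) ℂ ε) →ₗ[ℂ] ℂ :=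
  (MvPolynomial.aeval z).toLinearMap.comp
    ((MvPolynomial.pderiv k).comp
      (MvPolynomial.restrictTotalDegree (Fin N) ℂ ε).subtype)

@[simp]
theorem evalDeg_apply (N ε : ℕ) (z : Fin N → ℂ)
    (u : ↥(MvPolynomial.restrictTotalDegree (Fin N) ℂ ε)) :
    evalDeg N ε z u = MvPolynomial.aeval z (u : MvPolynomial (Fin N) ℂ) := rfl

@[simp]
theorem pderivEvalDeg_apply (N ε : ℕ) (z : Fin N → ℂ) (k : Fin N)
    (u : ↥(MvPolynomial.restrictTotalDegree (Fin N) ℂ ε)) :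
    pderivEvalDeg N ε z k u =
      MvPolynomial.aeval z (MvPolynomial.pderiv k (u : MvPolynomial (Fin N) ℂ)) := rfl

/-- Claim 4.12 ("claim0") of the paper: if `(z, ξ)` does not lie in
`W = ⋃_i {z_i = 0, ξ_i = 0}` and `ξ ≠ 0`, then for every `q` the linear
functional `β_q(u) = z_q·Σ_k (∂u/∂x_k)(z)·ξ_k + e·u(z)·ξ_q` on `𝔸_ε` is
nonzero and its kernel differs from that of `b_q(u) = z_q·u(z)`. -/
theorem beta_ne_zero_and_ker_ne
    (N ε e : ℕ) (hN : 1 ≤ N) (hε : 1 ≤ ε) (he : 1 ≤ e)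
    (z ξ : Fin N → ℂ) (hξ : ξ ≠ 0)
    (hW : ∀ i : Fin N, ¬ (z i = 0 ∧ ξ i = 0)) (q : Fin N) :
    (z q • (∑ k : Fin N, ξ k • pderivEvalDeg N ε z k) +
        ((e : ℂ) * ξ q) • evalDeg N ε z) ≠ 0 ∧
    LinearMap.ker (z q • evalDeg N ε z) ≠
      LinearMap.ker (z q • (∑ k : Fin N, ξ k • pderivEvalDeg N ε z k) +
        ((e : ℂ) * ξ q) • evalDeg N ε z) := by
  obtain ⟨u, hb, hβ⟩ : ∃ u : ↥(MvPolynomial.restrictTotalDegree (Fin N) ℂ ε),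
      (z q • evalDeg N ε z) u = 0 ∧
      (z q • (∑ k : Fin N, ξ k • pderivEvalDeg N ε z k) +
        ((e : ℂ) * ξ q) • evalDeg N ε z) u ≠ 0 := by
    by_cases hq : z q = 0
    · have hξq : ξ q ≠ 0 := fun h => hW q ⟨hq, h⟩
      have he' : (e : ℂ) ≠ 0 := Nat.cast_ne_zero.mpr (by lia)
      refine ⟨⟨1, ?_⟩, ?_, ?_⟩
      · simp [MvPolynomial.mem_restrictTotalDegree]
      · simp [hq]
      · simp [hq, hξq, he']
    · obtain ⟨j, hj⟩ := Function.ne_iff.mp hξ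
      refine ⟨⟨MvPolynomial.X j - MvPolynomial.C (z j), ?_⟩, ?_, ?_⟩
      · rw [MvPolynomial.mem_restrictTotalDegree]
        exact (MvPolynomial.totalDegree_sub_C_le _ _).trans
          ((MvPolynomial.totalDegree_X j).le.trans hε)
      · simp
      · simpa [hq, MvPolynomial.pderiv_X, Pi.single_apply, apply_ite] using hj
  exact ⟨fun h => hβ (by rw [h, LinearMap.zero_apply]),
    fun h => hβ (LinearMap.mem_ker.mp (h ▸ LinearMap.mem_ker.mpr hb))⟩
end

section
/- Let e ≥ 5 be an integer and set e₁ := ⌊e/2⌋ and e₂ := ⌈e/2⌉. Then every 5-tuple (i₀, i₁, i₂, i₃, i₄) of natural numbers with i₀ + i₁ + i₂ + i₃ + i₄ = 4e satisfies at least one of the following conditions: (i) i_j ≥ e for some j ∈ {0, 1, 2, 3, 4}; (ii) i₀ ≥ e₁ and i₁ ≥ e₂ + 1; (iii) i₀ ≥ e₁ + 1 and i₁ ≥ e₂; (iv) i₂ ≥ e₁ and i₃ ≥ e₂ + 1; (v) i₂ ≥ e₁ + 1 and i₃ ≥ e₂. -/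
/-- The combinatorial step of Proposition `PropFamille`: for `e ≥ 5`, with
`e₁ = ⌊e/2⌋` and `e₂ = ⌈e/2⌉`, every multi-index `(i₀,…,i₄)` of total degree
`4e` satisfies one of the five stated conditions. -/
theorem multiindex_cover (e : ℕ) (he : 5 ≤ e) (i : Fin 5 → ℕ)
    (hsum : i 0 + i 1 + i 2 + i 3 + i 4 = 4 * e) :
    (∃ j : Fin 5, e ≤ i j) ∨
    (e / 2 ≤ i 0 ∧ (e + 1) / 2 + 1 ≤ i 1) ∨
    (e / 2 + 1 ≤ i 0 ∧ (e + 1) / 2 ≤ i 1) ∨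
    (e / 2 ≤ i 2 ∧ (e + 1) / 2 + 1 ≤ i 3) ∨
    (e / 2 + 1 ≤ i 2 ∧ (e + 1) / 2 ≤ i 3) := by
  by_cases h : ∃ j : Fin 5, e ≤ i j
  · exact Or.inl h
  · push Not at h
    have h0 := h 0
    have h1 := h 1
    have h2 := h 2
    have h3 := h 3
    have h4 := h 4
    -- One of the pairs `i 0 + i 1`, `i 2 + i 3` is at least `(3 * e + 1) / 2`.
    rcases le_total (i 2 + i 3) (i 0 + i 1) with hle | hle
    · exact Or.inr (Or.inl ⟨by omega, by omega⟩)
    · exact Or.inr (Or.inr (Or.inr (Or.inl ⟨by omega, by omega⟩)))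
end
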